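/- arXiv:1507.06494 — 11 statements merged into one kernel-verified Lean document; each statement's English description precedes it below -/
import Mathlib

section
/- Let R be a commutative ring, let M and N be R-modules, and let d_M : M → M, d_N : N → N and σ : M → M be R-linear maps such that σ ∘ σ = id_M and σ ∘ d_M = − d_M ∘ σ. Suppose there are elements a, b ∈ R with d_M ∘ d_M = a • id_M and d_N ∘ d_N = b • id_N. Then the R-linear endomorphism D := d_M ⊗ id_N + σ ⊗ d_N of M ⊗_R N satisfies D ∘ D = (a + b) • id_{M ⊗_R N}. -/
open TensorProduct

/-- The tensor product of two "twisted differentials" squaring to scalars `a` and `b`,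
formed with the Koszul sign rule (via a grading involution `σ`), squares to `a + b`. -/
theorem tensor_differential_squares {R : Type*} [CommRing R] {M N : Type*}
    [AddCommGroup M] [AddCommGroup N] [Module R M] [Module R N]
    (dM : M →ₗ[R] M) (dN : N →ₗ[R] N) (σ : M →ₗ[R] M)
    (hσσ : σ ∘ₗ σ = LinearMap.id)
    (hσd : σ ∘ₗ dM = -(dM ∘ₗ σ))
    (a b : R)
    (hM : dM ∘ₗ dM = a • LinearMap.id)
    (hN : dN ∘ₗ dN = b • LinearMap.id) :
    letI D : M ⊗[R] N →ₗ[R] M ⊗[R] N :=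
      TensorProduct.map dM LinearMap.id + TensorProduct.map σ dN
    D ∘ₗ D = (a + b) • LinearMap.id := by
  have hneg : TensorProduct.map (-(dM ∘ₗ σ)) dN = -TensorProduct.map (dM ∘ₗ σ) dN := by
    ext m n
    simp [TensorProduct.neg_tmul]
  simp only [LinearMap.add_comp, LinearMap.comp_add, ← TensorProduct.map_comp, hσσ, hσd, hM, hN,
    LinearMap.id_comp, LinearMap.comp_id, hneg, TensorProduct.map_smul_left,
    TensorProduct.map_smul_right, TensorProduct.map_id, add_smul]
  abel
end

section
/- Let d ≥ 2 be an integer, let η = exp(2πi/d) ∈ ℂ, and for a subset J ⊆ {0,1,…,d−1} write π_J(x,y) = ∏_{j∈J} (x − η^j y) ∈ ℂ[x,y]. Let R and S be nonempty proper subsets of {0,1,…,d−1}, and suppose f₀, f₁ ∈ ℂ[x,y] both have nonzero constant coefficient and satisfy f₀ · π_R = π_S · f₁ and f₁ · π_{R^c} = π_{S^c} · f₀, where R^c and S^c denote the complements in {0,1,…,d−1}. Then R = S. -/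
open MvPolynomial

/-- If `∏ j ∈ R, (x - a j * y)` divides `(∏ j ∈ S, (x - a j * y)) * g` and `g` does not vanish at the
origin, then restricting to the line `x = a j * y` shows that every slope over `R` is a slope
over `S`. -/
theorem exists_slope_eq_of_mul_prod_eq {K ι : Type*} [Field K] (a : ι → K) {R S : Finset ι}
    {f g : MvPolynomial (Fin 2) K} (hg : MvPolynomial.coeff 0 g ≠ 0)
    (h : f * ∏ j ∈ R, (X 0 - C (a j) * X 1) = (∏ j ∈ S, (X 0 - C (a j) * X 1)) * g)
    {j : ι} (hj : j ∈ R) : ∃ k ∈ S, a j = a k := by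
  let φ : MvPolynomial (Fin 2) K →ₐ[K] Polynomial K :=
    aeval ![Polynomial.C (a j) * Polynomial.X, Polynomial.X]
  have hlin (k : ι) :
      φ (X 0 - C (a k) * X 1) = Polynomial.C (a j - a k) * Polynomial.X := by
    simp [φ, MvPolynomial.algHom_C, Polynomial.algebraMap_eq, sub_mul]
  have hconst : (Polynomial.aeval (0 : K)).comp φ = aeval (0 : Fin 2 → K) := by
    ext i
    fin_cases i <;> simp [φ]
  have hφg : φ g ≠ 0 := fun h0 => hg <| by
    have := DFunLike.congr_fun hconst g
    simpa [h0, aeval_zero, constantCoeff_eq, eq_comm] using this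
  have hφ := congrArg φ h
  rw [map_mul, map_mul, map_prod, map_prod,
    Finset.prod_eq_zero hj (by rw [hlin, sub_self, map_zero, zero_mul]), mul_zero] at hφ
  obtain ⟨k, hk, hk0⟩ :=
    Finset.prod_eq_zero_iff.mp ((mul_eq_zero.mp hφ.symm).resolve_right hφg)
  refine ⟨k, hk, sub_eq_zero.mp ?_⟩
  simpa [hlin, -map_sub] using hk0

/-- If a morphism `(f₀, f₁)` between permutation-type matrix bifactorizations `P_R → P_S`
of `x^d − y^d` has components with nonzero constant coefficient, then `R = S`. -/
theorem perm_mf_iso_imp_eq (d : ℕ) (hd : 2 ≤ d)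
    (η : ℂ) (hη : η = Complex.exp (2 * Real.pi * Complex.I / d))
    (R S : Finset ℕ) (hR : R ⊆ Finset.range d) (hS : S ⊆ Finset.range d)
    (hRne : R.Nonempty) (hSne : S.Nonempty)
    (hRpr : R ≠ Finset.range d) (hSpr : S ≠ Finset.range d)
    (f₀ f₁ : MvPolynomial (Fin 2) ℂ)
    (hf₀ : MvPolynomial.coeff 0 f₀ ≠ 0) (hf₁ : MvPolynomial.coeff 0 f₁ ≠ 0)
    (h1 : f₀ * ∏ j ∈ R, (X 0 - C (η ^ j) * X 1)
        = (∏ j ∈ S, (X 0 - C (η ^ j) * X 1)) * f₁)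
    (h2 : f₁ * ∏ j ∈ (Finset.range d \ R), (X 0 - C (η ^ j) * X 1)
        = (∏ j ∈ (Finset.range d \ S), (X 0 - C (η ^ j) * X 1)) * f₀) :
    R = S := by
  have hprim : IsPrimitiveRoot η d := hη ▸ Complex.isPrimitiveRoot_exp d (by omega)
  apply Finset.Subset.antisymm
  · intro j hj
    obtain ⟨k, hk, hjk⟩ := exists_slope_eq_of_mul_prod_eq (fun j => η ^ j) hf₁ h1 hj
    rwa [hprim.pow_inj (Finset.mem_range.mp (hR hj)) (Finset.mem_range.mp (hS hk)) hjk]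
  · intro j hj
    have h1' : f₁ * ∏ j ∈ S, (X 0 - C (η ^ j) * X 1)
        = (∏ j ∈ R, (X 0 - C (η ^ j) * X 1)) * f₀ := by
      rw [mul_comm, ← h1, mul_comm]
    obtain ⟨k, hk, hjk⟩ := exists_slope_eq_of_mul_prod_eq (fun j => η ^ j) hf₀ h1' hj
    rwa [hprim.pow_inj (Finset.mem_range.mp (hS hj)) (Finset.mem_range.mp (hR hk)) hjk]
end

section
/- Let d ≥ 2 be an integer, let η = exp(2πi/d) ∈ ℂ, and for a subset J ⊆ {0,1,…,d−1} write π_J(x,y) = ∏_{j∈J} (x − η^j y) ∈ ℂ[x,y]. Let R and S be nonempty proper subsets of {0,1,…,d−1}, and suppose p, q ∈ ℂ[x,y] are nonzero polynomials such that p is homogeneous of total degree e with 2e = |S| − |R| (as integers), and p · π_R = π_S · q. Then R = S, and p and q are equal nonzero constants. -/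
open MvPolynomial

theorem MvPolynomial.IsHomogeneous.eval_smul {σ R : Type*} [CommSemiring R]
    {p : MvPolynomial σ R} {n : ℕ} (hp : p.IsHomogeneous n) (c : R) (x : σ → R) :
    eval (c • x) p = c ^ n * eval x p := by
  rw [eval_eq, eval_eq, Finset.mul_sum]
  refine Finset.sum_congr rfl fun m hm => ?_
  rw [hp.degree_eq_sum_deg_support hm, ← Finset.prod_pow_eq_pow_sum]
  simp only [Pi.smul_apply, smul_eq_mul, mul_pow, Finset.prod_mul_distrib]
  ring

theorem MvPolynomial.polynomial_eval_dehomogenize {R : Type*} [CommSemiring R]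
    (p : MvPolynomial (Fin 2) R) (t : R) :
    (aeval ![(Polynomial.X : Polynomial R), 1] p).eval t = eval ![t, 1] p := by
  induction p using MvPolynomial.induction_on with
  | C a => simp
  | add p q hp hq => simp [hp, hq]
  | mul_X p i hp => fin_cases i <;> simp [hp]

/-- A nonzero binary form stays nonzero after setting its second variable to `1`. -/
theorem MvPolynomial.IsHomogeneous.aeval_dehomogenize_ne_zero {K : Type*} [Field K] [Infinite K]
    {p : MvPolynomial (Fin 2) K} {n : ℕ} (hp : p.IsHomogeneous n) (hp0 : p ≠ 0) :
    MvPolynomial.aeval ![(Polynomial.X : Polynomial K), 1] p ≠ 0 := by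
  intro h0
  have eval_line (t : K) : eval ![t, 1] p = 0 := by
    rw [← polynomial_eval_dehomogenize, h0, Polynomial.eval_zero]
  have hmul : p * X 1 = 0 := by
    refine MvPolynomial.funext fun x => ?_
    by_cases hx : x 1 = 0
    · simp [hx]
    · have hscale : x = x 1 • ![x 0 / x 1, 1] := by
        ext i
        fin_cases i <;> simp [mul_div_cancel₀, hx]
      rw [map_mul, hscale, hp.eval_smul, eval_line]
      simp
  exact (mul_ne_zero hp0 (X_ne_zero 1)) hmul

/-- A nonzero binary form has at most as many roots on an affine line as its degree. -/
theorem MvPolynomial.IsHomogeneous.card_le_of_eval_eq_zero {K : Type*} [Field K] [Infinite K]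
    {p : MvPolynomial (Fin 2) K} {n : ℕ} (hp : p.IsHomogeneous n) (hp0 : p ≠ 0)
    (Z : Finset K) (hZ : ∀ t ∈ Z, eval ![t, 1] p = 0) : Z.card ≤ n := by
  have hdeg := aeval_natDegree_le (n := 1) p hp.totalDegree_le
    ![(Polynomial.X : Polynomial K), 1] (by intro i; fin_cases i <;> simp)
  rw [mul_one] at hdeg
  refine (Polynomial.card_le_degree_of_subset_roots fun t ht => ?_).trans hdeg
  rw [Polynomial.mem_roots (hp.aeval_dehomogenize_ne_zero hp0), Polynomial.IsRoot,
    polynomial_eval_dehomogenize]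
  exact hZ t ht

/-- Graded morphisms between graded permutation-type matrix bifactorizations:
if `p` is nonzero homogeneous of degree `e` with `2e = |S| − |R|` and
`p · π_R = π_S · q` with `q ≠ 0`, then `R = S` and `p, q` are equal nonzero constants. -/
theorem graded_perm_mf_morphism (d : ℕ) (hd : 2 ≤ d)
    (η : ℂ) (hη : η = Complex.exp (2 * Real.pi * Complex.I / d))
    (R S : Finset ℕ) (hR : R ⊆ Finset.range d) (hS : S ⊆ Finset.range d)
    (hRne : R.Nonempty) (hSne : S.Nonempty)
    (hRpr : R ≠ Finset.range d) (hSpr : S ≠ Finset.range d)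
    (p q : MvPolynomial (Fin 2) ℂ) (hp : p ≠ 0) (hq : q ≠ 0)
    (e : ℕ) (hhom : p.IsHomogeneous e)
    (hdeg : (2 * e : ℤ) = (S.card : ℤ) - (R.card : ℤ))
    (h : p * ∏ j ∈ R, (X 0 - C (η ^ j) * X 1)
        = (∏ j ∈ S, (X 0 - C (η ^ j) * X 1)) * q) :
    R = S ∧ ∃ c : ℂ, c ≠ 0 ∧ p = C c ∧ q = C c := by
  have hprim : IsPrimitiveRoot η d := hη ▸ Complex.isPrimitiveRoot_exp d (by omega)
  have pow_inj {i j : ℕ} (hi : i ∈ Finset.range d) (hj : j ∈ Finset.range d)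
      (hij : η ^ i = η ^ j) : i = j :=
    hprim.pow_inj (Finset.mem_range.1 hi) (Finset.mem_range.1 hj) hij
  have hroots : ∀ t ∈ (S \ R).image (η ^ ·), eval ![t, 1] p = 0 := by
    intro t ht
    obtain ⟨j, hj, rfl⟩ := Finset.mem_image.1 ht
    obtain ⟨hjS, hjR⟩ := Finset.mem_sdiff.1 hj
    have hev := congrArg (eval ![η ^ j, 1]) h
    simp only [map_mul, map_prod, map_sub, eval_X, eval_C, Matrix.cons_val_zero,
      Matrix.cons_val_one, mul_one] at hev
    rw [Finset.prod_eq_zero hjS (sub_self _), zero_mul] at hev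
    refine (mul_eq_zero.1 hev).resolve_right (Finset.prod_ne_zero_iff.2 fun i hi hij => ?_)
    exact hjR (pow_inj (hS hjS) (hR hi) (sub_eq_zero.1 hij) ▸ hi)
  have hcard := hhom.card_le_of_eval_eq_zero hp _ hroots
  rw [Finset.card_image_of_injOn fun i hi j hj hij =>
    pow_inj (hS (Finset.mem_sdiff.1 hi).1) (hS (Finset.mem_sdiff.1 hj).1) hij] at hcard
  have hsdiff := Finset.le_card_sdiff R S
  obtain rfl : e = 0 := by omega
  have hSR : S ⊆ R := Finset.sdiff_eq_empty_iff_subset.1 (Finset.card_eq_zero.1 (by omega))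
  obtain rfl : S = R := Finset.eq_of_subset_of_card_le hSR (by omega)
  have hpC : p = C (p.coeff 0) := totalDegree_eq_zero_iff_eq_C.1 (hhom.totalDegree hp)
  have hprod : ∏ j ∈ S, (X 0 - C (η ^ j) * X 1 : MvPolynomial (Fin 2) ℂ) ≠ 0 := by
    refine Finset.prod_ne_zero_iff.2 fun j _ h0 => ?_
    simpa using congrArg (eval ![1, 0]) h0
  have hpq : p = q := mul_right_cancel₀ hprod (h.trans (mul_comm _ _))
  refine ⟨rfl, p.coeff 0, fun hc => hp ?_, hpC, hpq ▸ hpC⟩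
  rw [hpC, hc, C_0]
end

section
/- Let b ≥ 1 be an integer and let s ∈ ℂ satisfy s^{2b} = 1. Then in the polynomial ring ℂ[u,v,x,y] the identity (x − s²u²) · ( ∑_{k=0}^{b−1} x^k (s u)^{2(b−1−k)} + y² ) − (v + y s u)(v − y s u) = x^b + x y² − u^{2b} − v² holds. -/
open MvPolynomial

/-- Determinant identity for the rank-two matrix factorization establishing
the orbifold equivalence `W^(A_{2b−1}) ∼ W^(D_{b+1})`. -/
theorem det_Dcase (b : ℕ) (hb : 1 ≤ b) (s : ℂ) (hs : s ^ (2 * b) = 1) :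
    letI u : MvPolynomial (Fin 4) ℂ := X 0
    letI v : MvPolynomial (Fin 4) ℂ := X 1
    letI x : MvPolynomial (Fin 4) ℂ := X 2
    letI y : MvPolynomial (Fin 4) ℂ := X 3
    (x - (C s * u) ^ 2)
        * ((∑ k ∈ Finset.range b, x ^ k * (C s * u) ^ (2 * (b - 1 - k))) + y ^ 2)
      - (v + y * (C s * u)) * (v - y * (C s * u))
      = x ^ b + x * y ^ 2 - u ^ (2 * b) - v ^ 2 := by
  have hgeom := (Commute.all (X 2 : MvPolynomial (Fin 4) ℂ) ((C s * X 0) ^ 2)).mul_geom_sum₂ b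
  simp only [← pow_mul] at hgeom
  have hsu : (C s * X 0 : MvPolynomial (Fin 4) ℂ) ^ (2 * b) = X 0 ^ (2 * b) := by
    rw [mul_pow, ← C_pow, hs, C_1, one_mul]
  rw [hsu] at hgeom
  linear_combination hgeom
end

section
/- Let s, t ∈ ℂ satisfy t² = 1/3 and s¹² = −576(26t − 15). In ℂ[u,v,x,y], set a = y² − v + (1/2)x(su)² + ((2t+1)/8)(su)⁶, d = y² + v + (1/2)x(su)² + ((2t+1)/8)(su)⁶, b = −x + y(su) + ((t+1)/4)(su)⁴, and c = x² + yx(su) + (t/4)x(su)⁴ + ((2t+1)/4)y(su)⁵ − ((9t+5)/48)(su)⁸. Then a·d − b·c = x³ + y⁴ − u¹² − v². -/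
open MvPolynomial

/-- Determinant identity for the rank-two matrix factorization establishing
the orbifold equivalence `W^(E₆) ∼ W^(A₁₁)`. -/
theorem det_E6case (s t : ℂ) (ht : t ^ 2 = 1 / 3)
    (hs : s ^ 12 = -576 * (26 * t - 15)) :
    letI u : MvPolynomial (Fin 4) ℂ := X 0
    letI v : MvPolynomial (Fin 4) ℂ := X 1
    letI x : MvPolynomial (Fin 4) ℂ := X 2
    letI y : MvPolynomial (Fin 4) ℂ := X 3
    letI a := y ^ 2 - v + C ((1 : ℂ) / 2) * x * (C s * u) ^ 2
      + C ((2 * t + 1) / 8) * (C s * u) ^ 6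
    letI dd := y ^ 2 + v + C ((1 : ℂ) / 2) * x * (C s * u) ^ 2
      + C ((2 * t + 1) / 8) * (C s * u) ^ 6
    letI bb := -x + y * (C s * u) + C ((t + 1) / 4) * (C s * u) ^ 4
    letI cc := x ^ 2 + y * x * (C s * u) + C (t / 4) * x * (C s * u) ^ 4
      + C ((2 * t + 1) / 4) * y * (C s * u) ^ 5 - C ((9 * t + 5) / 48) * (C s * u) ^ 8
    a * dd - bb * cc = x ^ 3 + y ^ 4 - u ^ 12 - v ^ 2 := by
  refine MvPolynomial.funext fun p => ?_
  simp only [map_add, map_sub, map_mul, map_pow, map_neg, eval_X, eval_C]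
  linear_combination
    (-(p 2) * (s * p 0) ^ 8 / 16 - p 3 * (s * p 0) ^ 9 / 8 + 21 / 192 * (s * p 0) ^ 12
      - 2028 * p 0 ^ 12) * ht + (15 + 26 * t) / 192 * p 0 ^ 12 * hs
end

section
/- Let s, t ∈ ℂ satisfy t³ − 21t + 37 = 0 and s¹⁸ = 26220t² + 67488t − 376912. In ℂ[u,v,x,y], set a = v − ((t² − 10t + 19)/2)(su)⁹ + (t − 2)y(su)⁵ + y²(su), d = −v − ((t² − 10t + 19)/2)(su)⁹ + (t − 2)y(su)⁵ + y²(su), b = −x + (2t − 5)(su)⁶ + y(su)², and c = x² + y³ + (2t − 5)²(su)¹² + (2t − 5)x(su)⁶ + 2(2t − 5)y(su)⁸ + xy(su)² + y²(su)⁴. Then a·d − b·c = x³ + xy³ − u¹⁸ − v². -/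
open MvPolynomial

/-- Determinant identity for the rank-two matrix factorization establishing
the orbifold equivalence `W^(E₇) ∼ W^(A₁₇)`. -/
theorem det_E7case (s t : ℂ) (ht : t ^ 3 - 21 * t + 37 = 0)
    (hs : s ^ 18 = 26220 * t ^ 2 + 67488 * t - 376912) :
    letI u : MvPolynomial (Fin 4) ℂ := X 0
    letI v : MvPolynomial (Fin 4) ℂ := X 1
    letI x : MvPolynomial (Fin 4) ℂ := X 2
    letI y : MvPolynomial (Fin 4) ℂ := X 3
    letI a := v - C ((t ^ 2 - 10 * t + 19) / 2) * (C s * u) ^ 9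
      + C (t - 2) * y * (C s * u) ^ 5 + y ^ 2 * (C s * u)
    letI dd := -v - C ((t ^ 2 - 10 * t + 19) / 2) * (C s * u) ^ 9
      + C (t - 2) * y * (C s * u) ^ 5 + y ^ 2 * (C s * u)
    letI bb := -x + C (2 * t - 5) * (C s * u) ^ 6 + y * (C s * u) ^ 2
    letI cc := x ^ 2 + y ^ 3 + C ((2 * t - 5) ^ 2) * (C s * u) ^ 12
      + C (2 * t - 5) * x * (C s * u) ^ 6 + C (2 * (2 * t - 5)) * y * (C s * u) ^ 8
      + x * y * (C s * u) ^ 2 + y ^ 2 * (C s * u) ^ 4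
    a * dd - bb * cc = x ^ 3 + x * y ^ 3 - u ^ 18 - v ^ 2 := by
  have hlin : 2 * ((t ^ 2 - 10 * t + 19) / 2) * (t - 2) + 3 * (2 * t - 5) ^ 2 = 0 := by
    linear_combination ht
  have hconst : (((t ^ 2 - 10 * t + 19) / 2) ^ 2 - (2 * t - 5) ^ 3) * s ^ 18 = -1 := by
    rw [hs]
    grind
  have hhalf : 2 * ((t ^ 2 - 10 * t + 19) / 2) = t ^ 2 - 10 * t + 19 := by ring
  generalize (t ^ 2 - 10 * t + 19) / 2 = p at *
  have hlin' := congrArg (C (σ := Fin 4)) hlin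
  have hconst' := congrArg (C (σ := Fin 4)) hconst
  have hhalf' := congrArg (C (σ := Fin 4)) hhalf
  simp only [map_add, map_sub, map_mul, map_pow, map_neg, map_one, map_zero, map_ofNat]
    at hlin' hconst' hhalf' ⊢
  linear_combination X 0 ^ 18 * hconst' - X 3 * (C s * X 0) ^ 14 * hlin'
    - X 3 ^ 2 * (C s * X 0) ^ 10 * hhalf'
end

section
/- Let d ≥ 1 be an integer and let a ∈ ℂ satisfy a^d = −2i. Then in the polynomial ring ℂ[u,v,x,y] the identity (x − a u) · y · ( ∑_{k=0}^{d−1} x^k (a u)^{d−1−k} ) + (y − i u^d − v)(y − i u^d + v) = x^d y + y² − u^{2d} − v² holds, where i is the imaginary unit. -/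
open MvPolynomial

/-- Determinant identity for the rank-two matrix factorization establishing the orbifold
equivalence between the Berglund–Hübsch transpose `W^T_{D_{d+1}} = x^d y + y²` and
`W_{A_{d−1}} = u^{2d} + v²`. -/
theorem det_BH_Dcase (d : ℕ) (hd : 1 ≤ d) (a : ℂ) (ha : a ^ d = -2 * Complex.I) :
    letI u : MvPolynomial (Fin 4) ℂ := X 0
    letI v : MvPolynomial (Fin 4) ℂ := X 1
    letI x : MvPolynomial (Fin 4) ℂ := X 2
    letI y : MvPolynomial (Fin 4) ℂ := X 3
    (x - C a * u) * y * (∑ k ∈ Finset.range d, x ^ k * (C a * u) ^ (d - 1 - k))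
      + (y - C Complex.I * u ^ d - v) * (y - C Complex.I * u ^ d + v)
      = x ^ d * y + y ^ 2 - u ^ (2 * d) - v ^ 2 := by
  have hgeom := (Commute.all (X 2 : MvPolynomial (Fin 4) ℂ) (C a * X 0)).mul_geom_sum₂ d
  have hC : (C a : MvPolynomial (Fin 4) ℂ) ^ d = -2 * C Complex.I := by
    rw [← C_pow, ha, C_mul, C_neg, map_ofNat]
  have hI : (C Complex.I : MvPolynomial (Fin 4) ℂ) ^ 2 = -1 := by
    rw [← C_pow, Complex.I_sq, C_neg, C_1]
  rw [mul_pow, hC] at hgeom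
  linear_combination X 3 * hgeom + (X 0 ^ d) ^ 2 * hI
end

section
/- Let K be a field, let m ≥ 1 be an integer, and let a₁, …, a_m be nonzero elements of K. Define w_k = 2 · ∑_{i=k}^{m} (−1)^{i−k} ∏_{l=k}^{i} a_l^{−1} for 1 ≤ k ≤ m. Then a_m · w_m = 2, and a_k · w_k + w_{k+1} = 2 for every 1 ≤ k < m. -/
/-- Splitting off the first term of an alternating sum of partial products. -/
theorem sum_Icc_neg_one_pow_mul_prod_Icc {R : Type*} [CommRing R] (b : ℕ → R) {k m : ℕ}
    (hkm : k ≤ m) :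
    ∑ i ∈ Finset.Icc k m, (-1 : R) ^ (i - k) * ∏ l ∈ Finset.Icc k i, b l
      = b k * (1 - ∑ i ∈ Finset.Icc (k + 1) m,
          (-1 : R) ^ (i - (k + 1)) * ∏ l ∈ Finset.Icc (k + 1) i, b l) := by
  have hterm : ∀ i ∈ Finset.Icc (k + 1) m,
      (-1 : R) ^ (i - k) * ∏ l ∈ Finset.Icc k i, b l
        = -b k * ((-1 : R) ^ (i - (k + 1)) * ∏ l ∈ Finset.Icc (k + 1) i, b l) := by
    intro i hi
    have hki : k + 1 ≤ i := (Finset.mem_Icc.mp hi).1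
    rw [← Finset.insert_Icc_add_one_left_eq_Icc (by lia : k ≤ i),
      Finset.prod_insert (by simp), show i - k = i - (k + 1) + 1 by lia, pow_succ]
    ring
  rw [← Finset.insert_Icc_add_one_left_eq_Icc hkm, Finset.sum_insert (by simp),
    Finset.sum_congr rfl hterm, ← Finset.mul_sum]
  simp only [Nat.sub_self, pow_zero, one_mul, Finset.Icc_self, Finset.prod_singleton]
  ring

/-- Closed formula for the weights of the variables of a chain-type invertible polynomial:
`w_k = 2 ∑_{i=k}^m (−1)^{i−k} ∏_{l=k}^i a_l⁻¹` solves `a_m w_m = 2` and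
`a_k w_k + w_{k+1} = 2` for `1 ≤ k < m`. -/
theorem chain_weights {K : Type*} [Field K] (m : ℕ) (hm : 1 ≤ m) (a : ℕ → K)
    (ha : ∀ k, 1 ≤ k → k ≤ m → a k ≠ 0)
    (w : ℕ → K)
    (hw : ∀ k, w k
      = 2 * ∑ i ∈ Finset.Icc k m, (-1 : K) ^ (i - k) * ∏ l ∈ Finset.Icc k i, (a l)⁻¹) :
    a m * w m = 2 ∧ ∀ k, 1 ≤ k → k < m → a k * w k + w (k + 1) = 2 := by
  refine ⟨?_, fun k hk hkm => ?_⟩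
  · have ham := ha m hm le_rfl
    simp [hw, mul_left_comm (a m), ham]
  · have hak := ha k hk hkm.le
    rw [hw k, hw (k + 1), sum_Icc_neg_one_pow_mul_prod_Icc _ hkm.le]
    field_simp
    ring
end

section
/- Let K be a field, let n ≥ 1, let E be an invertible n×n matrix over K, and let 𝟙 ∈ Kⁿ denote the all-ones vector. Suppose w, w' ∈ Kⁿ satisfy E·w = 2·𝟙 and Eᵀ·w' = 2·𝟙, where Eᵀ is the transpose of E. Then ∑_{i=1}^{n} w_i = ∑_{i=1}^{n} w'_i, and consequently ∑_{i=1}^{n} (1 − w_i) = ∑_{i=1}^{n} (1 − w'_i). -/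
open Matrix in
/-- The solutions of `E *ᵥ w = c • 1` and `Eᵀ *ᵥ w' = c • 1` have the same sum of entries. -/
theorem Matrix.sum_eq_sum_of_mulVec_eq_const {ι R : Type*} [Fintype ι] [DecidableEq ι] [CommRing R]
    {E : Matrix ι ι R} (hE : IsUnit E.det) {c : R} {w w' : ι → R}
    (hw : E *ᵥ w = fun _ => c) (hw' : Eᵀ *ᵥ w' = fun _ => c) :
    ∑ i, w i = ∑ i, w' i := by
  have hw_eq : w = c • (E⁻¹ *ᵥ 1) := by
    have hc : (fun _ => c : ι → R) = c • 1 := by ext; simp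
    rw [← mulVec_smul, ← hc, ← hw, mulVec_mulVec, nonsing_inv_mul _ hE, one_mulVec]
  calc ∑ i, w i = (fun _ => c) ⬝ᵥ (E⁻¹ *ᵥ 1) := by
        rw [hw_eq]; simp [dotProduct]
    _ = w' ⬝ᵥ (E *ᵥ (E⁻¹ *ᵥ 1)) := by
        rw [← hw', mulVec_transpose, ← dotProduct_mulVec]
    _ = ∑ i, w' i := by
        rw [mulVec_mulVec, mul_nonsing_inv _ hE, one_mulVec, dotProduct_one]

/-- An invertible polynomial has the same central charge as its Berglund–Hübsch transpose:
if `E·w = 2·𝟙` and `Eᵀ·w' = 2·𝟙` with `E` invertible, then `∑ wᵢ = ∑ w'ᵢ` and hence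
`∑ (1 − wᵢ) = ∑ (1 − w'ᵢ)`. -/
theorem central_charge_BH_transpose {K : Type*} [Field K] (n : ℕ) (hn : 1 ≤ n)
    (E : Matrix (Fin n) (Fin n) K) (hE : IsUnit E.det)
    (w w' : Fin n → K)
    (hw : E.mulVec w = fun _ => 2)
    (hw' : E.transpose.mulVec w' = fun _ => 2) :
    (∑ i, w i = ∑ i, w' i) ∧ (∑ i, (1 - w i) = ∑ i, (1 - w' i)) := by
  have h := Matrix.sum_eq_sum_of_mulVec_eq_const hE hw hw'
  exact ⟨h, by rw [Finset.sum_sub_distrib, Finset.sum_sub_distrib, h]⟩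
end

section
/- Let d ≥ 2 be an integer, η = exp(2πi/d) ∈ ℂ, let a, b be integers and μ ≥ 0 an integer. Define p₁(x,y) = (x − η^a y)(x − η^{a+1} y), p_μ(y,z) = ∏_{j=b}^{b+μ} (y − η^j z), q₋(x,z) = ∏_{j=a+b+1}^{a+b+μ} (x − η^j z), and g₀₀(x,y,z) = η^{−aμ} · ( −η^{−a−1}·((1 − η^{−μ})/(1 − η^{−1}))·x + ((1 − η^{−μ−1})/(1 − η^{−1}))·y − η^{b}·z ). Then p₁(x,y) divides q₋(x,z)·g₀₀(x,y,z) − p_μ(y,z) in ℂ[x,y,z]. -/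
open MvPolynomial

/-- Divisibility by two lines through the origin, combined into divisibility by their product. -/
theorem sub_mul_sub_dvd {R : Type*} [CommRing R] [IsDomain R] {x y α β N : R}
    (hy : Prime y) (hxy : ¬ y ∣ x) (hαβ : IsUnit (β - α))
    (hα : x - α * y ∣ N) (hβ : x - β * y ∣ N) :
    (x - α * y) * (x - β * y) ∣ N := by
  obtain ⟨A, rfl⟩ := hα
  obtain ⟨B, hB⟩ := hβ
  obtain ⟨γ, hγ⟩ := hαβ.exists_left_inv
  have hyA : y * A = (x - β * y) * (γ * (B - A)) := by
    linear_combination γ * hB - y * A * hγ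
  have hy_not_dvd : ¬ y ∣ x - β * y := fun h => hxy <| by
    simpa using dvd_add h (Dvd.intro_left β rfl)
  obtain ⟨E, hE⟩ := (hy.dvd_or_dvd (Dvd.intro A hyA)).resolve_left hy_not_dvd
  refine mul_dvd_mul_left _ ⟨E, mul_left_cancel₀ hy.ne_zero ?_⟩
  rw [hyA, hE]
  ring

section Specialization

variable {K S : Type*} [Field K] [CommRing S] (f : K →+* S) {η : K}

/-- Shifting the exponents in a product of linear forms `y - η ^ j z` by `k`. -/
theorem prod_Icc_add_zpow_sub (hη : η ≠ 0) (k m n : ℤ) (y z : S) :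
    ∏ j ∈ Finset.Icc (m + k) (n + k), (f (η ^ k) * y - f (η ^ j) * z) =
      f (η ^ k) ^ (n + 1 - m).toNat * ∏ j ∈ Finset.Icc m n, (y - f (η ^ j) * z) := by
  rw [← Finset.map_add_right_Icc, Finset.prod_map, ← Int.card_Icc, ← Finset.prod_const,
    ← Finset.prod_mul_distrib]
  refine Finset.prod_congr rfl fun j _ => ?_
  simp only [addRightEmbedding_apply, zpow_add₀ hη, map_mul]
  ring

/-- The numerator vanishes at `x = η ^ a y`. -/
theorem numerator_eq_zero_left (hη : η ≠ 0) (hη_one : η ≠ 1) (a b : ℤ) (μ : ℕ) (y z : S) :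
    (∏ j ∈ Finset.Icc (a + b + 1) (a + b + (μ : ℤ)), (f (η ^ a) * y - f (η ^ j) * z)) *
      (f (η ^ (-a * (μ : ℤ))) *
        (f (-η ^ (-a - 1) * ((1 - η ^ (-(μ : ℤ))) / (1 - η ^ (-1 : ℤ)))) * (f (η ^ a) * y)
          + f ((1 - η ^ (-(μ : ℤ) - 1)) / (1 - η ^ (-1 : ℤ))) * y - f (η ^ b) * z)) -
      ∏ j ∈ Finset.Icc b (b + (μ : ℤ)), (y - f (η ^ j) * z) = 0 := by
  have hsub : η - 1 ≠ 0 := sub_ne_zero.mpr hη_one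
  have hcoeff : -η ^ (-a - 1) * ((1 - η ^ (-(μ : ℤ))) / (1 - η ^ (-1 : ℤ))) * η ^ a
      + (1 - η ^ (-(μ : ℤ) - 1)) / (1 - η ^ (-1 : ℤ)) = 1 := by
    simp only [zpow_sub₀ hη, zpow_neg, zpow_one, zpow_natCast]
    field_simp
    ring
  have hscale : (η ^ a) ^ μ * η ^ (-a * (μ : ℤ)) = 1 := by
    rw [← zpow_natCast, ← zpow_mul, ← zpow_add₀ hη]
    simp
  have hIcc : Finset.Icc b (b + (μ : ℤ)) = insert b (Finset.Icc (b + 1) (b + (μ : ℤ))) := by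
    ext j
    simp only [Finset.mem_insert, Finset.mem_Icc]
    omega
  have hprod := prod_Icc_add_zpow_sub f hη a (b + 1) (b + μ) y z
  rw [show b + 1 + a = a + b + 1 by ring, show b + μ + a = a + b + μ by ring,
    show (b + μ + 1 - (b + 1)).toNat = μ by omega] at hprod
  rw [hprod, hIcc, Finset.prod_insert (by simp)]
  apply_fun f at hcoeff hscale
  simp only [map_mul, map_add, map_pow, map_one] at hcoeff hscale ⊢
  set P := ∏ j ∈ Finset.Icc (b + 1) (b + (μ : ℤ)), (y - f (η ^ j) * z)
  linear_combination (f (η ^ a) ^ μ * f (η ^ (-a * (μ : ℤ))) * P * y) * hcoeff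
    + P * (y - f (η ^ b) * z) * hscale

/-- The numerator vanishes at `x = η ^ (a + 1) y`. -/
theorem numerator_eq_zero_right (hη : η ≠ 0) (hη_one : η ≠ 1) (a b : ℤ) (μ : ℕ) (y z : S) :
    (∏ j ∈ Finset.Icc (a + b + 1) (a + b + (μ : ℤ)), (f (η ^ (a + 1)) * y - f (η ^ j) * z)) *
      (f (η ^ (-a * (μ : ℤ))) *
        (f (-η ^ (-a - 1) * ((1 - η ^ (-(μ : ℤ))) / (1 - η ^ (-1 : ℤ)))) * (f (η ^ (a + 1)) * y)
          + f ((1 - η ^ (-(μ : ℤ) - 1)) / (1 - η ^ (-1 : ℤ))) * y - f (η ^ b) * z)) -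
      ∏ j ∈ Finset.Icc b (b + (μ : ℤ)), (y - f (η ^ j) * z) = 0 := by
  have hsub : η - 1 ≠ 0 := sub_ne_zero.mpr hη_one
  have hcoeff : -η ^ (-a - 1) * ((1 - η ^ (-(μ : ℤ))) / (1 - η ^ (-1 : ℤ))) * η ^ (a + 1)
      + (1 - η ^ (-(μ : ℤ) - 1)) / (1 - η ^ (-1 : ℤ)) = η ^ (-(μ : ℤ)) := by
    simp only [zpow_sub₀ hη, zpow_add₀ hη, zpow_neg, zpow_one, zpow_natCast]
    field_simp
    ring
  have hscale : (η ^ (a + 1)) ^ μ * η ^ (-a * (μ : ℤ)) * η ^ (-(μ : ℤ)) = 1 := by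
    rw [← zpow_natCast, ← zpow_mul, ← zpow_add₀ hη, ← zpow_add₀ hη]
    ring_nf
    simp
  have hlast : η ^ b = η ^ (-(μ : ℤ)) * η ^ (b + (μ : ℤ)) := by
    rw [← zpow_add₀ hη]
    ring_nf
  have hIcc : Finset.Icc b (b + (μ : ℤ)) =
      insert (b + (μ : ℤ)) (Finset.Icc b (b + (μ : ℤ) - 1)) := by
    ext j
    simp only [Finset.mem_insert, Finset.mem_Icc]
    omega
  have hprod := prod_Icc_add_zpow_sub f hη (a + 1) b (b + μ - 1) y z
  rw [show b + (a + 1) = a + b + 1 by ring, show b + μ - 1 + (a + 1) = a + b + μ by ring,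
    show (b + μ - 1 + 1 - b).toNat = μ by omega] at hprod
  rw [hprod, hIcc, Finset.prod_insert (by simp)]
  apply_fun f at hcoeff hscale hlast
  simp only [map_mul, map_add, map_pow, map_one] at hcoeff hscale hlast ⊢
  set P := ∏ j ∈ Finset.Icc b (b + (μ : ℤ) - 1), (y - f (η ^ j) * z)
  linear_combination (f (η ^ (a + 1)) ^ μ * f (η ^ (-a * (μ : ℤ))) * P * y) * hcoeff
    - (f (η ^ (a + 1)) ^ μ * f (η ^ (-a * (μ : ℤ))) * P * z) * hlast
    + P * (y - f (η ^ (b + (μ : ℤ))) * z) * hscale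

end Specialization

/-- Polynomiality of the morphism component `g⁻₁₀`: the polynomial
`p₁(x,y) = (x − η^a y)(x − η^{a+1} y)` divides `q₋(x,z)·g₀₀(x,y,z) − p_μ(y,z)`. -/
theorem g10_is_polynomial (d : ℕ) (hd : 2 ≤ d)
    (η : ℂ) (hη : η = Complex.exp (2 * Real.pi * Complex.I / d))
    (a b : ℤ) (μ : ℕ) :
    letI x : MvPolynomial (Fin 3) ℂ := X 0
    letI y : MvPolynomial (Fin 3) ℂ := X 1
    letI z : MvPolynomial (Fin 3) ℂ := X 2
    letI p₁ : MvPolynomial (Fin 3) ℂ := (x - C (η ^ a) * y) * (x - C (η ^ (a + 1)) * y)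
    letI pmu : MvPolynomial (Fin 3) ℂ :=
      ∏ j ∈ Finset.Icc b (b + (μ : ℤ)), (y - C (η ^ j) * z)
    letI qminus : MvPolynomial (Fin 3) ℂ :=
      ∏ j ∈ Finset.Icc (a + b + 1) (a + b + (μ : ℤ)), (x - C (η ^ j) * z)
    letI g₀₀ : MvPolynomial (Fin 3) ℂ := C (η ^ (-a * (μ : ℤ))) *
      (C (-η ^ (-a - 1) * ((1 - η ^ (-(μ : ℤ))) / (1 - η ^ (-1 : ℤ)))) * x
        + C ((1 - η ^ (-(μ : ℤ) - 1)) / (1 - η ^ (-1 : ℤ))) * y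
        - C (η ^ b) * z)
    p₁ ∣ qminus * g₀₀ - pmu := by
  have hη_zero : η ≠ 0 := hη ▸ Complex.exp_ne_zero _
  have hη_one : η ≠ 1 := hη ▸ (Complex.isPrimitiveRoot_exp d (by omega)).ne_one (by omega)
  refine sub_mul_sub_dvd X_prime (by simp [X_dvd_X]) ?_ ?_ ?_
  · rw [← C_sub, zpow_add₀ hη_zero, zpow_one]
    refine IsUnit.map C (IsUnit.mk0 _ ?_)
    rw [← mul_sub_one]
    exact mul_ne_zero (zpow_ne_zero a hη_zero) (sub_ne_zero.mpr hη_one)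
  · rw [← Ideal.mem_span_singleton, ← Ideal.Quotient.eq_zero_iff_mem]
    set I : Ideal (MvPolynomial (Fin 3) ℂ) := Ideal.span _
    set π := Ideal.Quotient.mk I
    have hx : π (X 0) = π (C (η ^ a)) * π (X 1) := by
      rw [← map_mul]
      exact Ideal.Quotient.eq.mpr (Ideal.mem_span_singleton_self _)
    simpa only [map_sub, map_mul, map_add, map_prod, RingHom.comp_apply, ← hx] using
      numerator_eq_zero_left (π.comp C) hη_zero hη_one a b μ (π (X 1)) (π (X 2))
  · rw [← Ideal.mem_span_singleton, ← Ideal.Quotient.eq_zero_iff_mem]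
    set I : Ideal (MvPolynomial (Fin 3) ℂ) := Ideal.span _
    set π := Ideal.Quotient.mk I
    have hx : π (X 0) = π (C (η ^ (a + 1))) * π (X 1) := by
      rw [← map_mul]
      exact Ideal.Quotient.eq.mpr (Ideal.mem_span_singleton_self _)
    simpa only [map_sub, map_mul, map_add, map_prod, RingHom.comp_apply, ← hx] using
      numerator_eq_zero_right (π.comp C) hη_zero hη_one a b μ (π (X 1)) (π (X 2))
end

section
/- Let d ≥ 2 be an integer, η = exp(2πi/d) ∈ ℂ, let a, b be integers and let μ be an integer with 0 ≤ μ ≤ d−2. Define p₁(x,y) = (x − η^a y)(x − η^{a+1} y), p_μ(y,z) = ∏_{j=b}^{b+μ} (y − η^j z), q₋(x,z) = ∏_{j=a+b+1}^{a+b+μ} (x − η^j z), and g₀₀(x,y,z) = η^{−aμ} · ( −η^{−a−1}·((1 − η^{−μ})/(1 − η^{−1}))·x + ((1 − η^{−μ−1})/(1 − η^{−1}))·y − η^{b}·z ). Then q₋(x,z) divides x^d − z^d in ℂ[x,z] and p_μ(y,z) divides y^d − z^d in ℂ[y,z], and writing Q = (x^d − z^d)/q₋(x,z) and P = (y^d −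 z^d)/p_μ(y,z), the polynomial p₁(x,y) divides Q − P·g₀₀(x,y,z) in ℂ[x,y,z]. -/
open MvPolynomial

namespace MatrixFactorization

theorem prod_Icc_eq_prod_range {M : Type*} [CommMonoid M] (f : ℤ → M) (m : ℤ) (n : ℕ) :
    ∏ j ∈ Finset.Icc m (m + n - 1), f j = ∏ i ∈ Finset.range n, f (m + i) := by
  refine (Finset.prod_bij (fun (i : ℕ) _ => m + (i : ℤ)) ?_ ?_ ?_ ?_).symm
  · intro i hi
    simp only [Finset.mem_range] at hi
    simp only [Finset.mem_Icc]
    omega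
  · intro i _ j _ h
    simpa using h
  · intro j hj
    simp only [Finset.mem_Icc] at hj
    exact ⟨(j - m).toNat, by simp only [Finset.mem_range]; omega, by omega⟩
  · intro i _
    rfl

/-- A product of at most `d` consecutive linear factors `x - η ^ j * z` divides `x ^ d - z ^ d`. -/
theorem prod_Icc_sub_dvd_pow_sub_pow {K R : Type*} [Field K] [CommRing R] [IsDomain R]
    [Algebra K R] {η : K} {d : ℕ} (hη : IsPrimitiveRoot η d) (hd : 0 < d) (x z : R)
    (m : ℤ) (n : ℕ) (hn : n ≤ d) :
    ∏ j ∈ Finset.Icc m (m + n - 1), (x - algebraMap K R (η ^ j) * z) ∣ x ^ d - z ^ d := by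
  classical
  have hinj : Function.Injective (algebraMap K R) := (algebraMap K R).injective
  have hη0 : η ≠ 0 := hη.ne_zero hd.ne'
  rw [(hη.map_of_injective hinj).pow_sub_pow_eq_prod_sub_mul x z hd, prod_Icc_eq_prod_range,
    ← Finset.prod_image (s := Finset.range n) (g := fun i : ℕ => algebraMap K R (η ^ (m + i)))
      (f := fun ζ => x - ζ * z)]
  · refine Finset.prod_dvd_prod_of_subset _ _ _ fun ζ hζ => ?_
    obtain ⟨i, -, rfl⟩ := Finset.mem_image.1 hζ
    rw [Polynomial.mem_nthRootsFinset hd, ← map_pow, ← zpow_natCast, ← zpow_mul, mul_comm,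
      zpow_mul, zpow_natCast, hη.pow_eq_one, one_zpow, map_one]
  · intro i hi j hj h
    simp only [Finset.coe_range, Set.mem_Iio] at hi hj
    have h' := hinj h
    rw [zpow_add₀ hη0, zpow_add₀ hη0, zpow_natCast, zpow_natCast] at h'
    exact hη.pow_inj (by omega) (by omega) (mul_left_cancel₀ (zpow_ne_zero m hη0) h')

/-- The substitution `x ↦ c * y` in `R[x, y, z]`. -/
noncomputable def substX {R : Type*} [CommRing R] (c : R) :
    MvPolynomial (Fin 3) R →ₐ[R] MvPolynomial (Fin 3) R :=
  aeval ![C c * X 1, X 1, X 2]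

section SubstX

variable {R : Type*} [CommRing R] (c : R)

@[simp] theorem substX_X_zero : substX c (X 0) = C c * X 1 := by simp [substX]

@[simp] theorem substX_X_one : substX c (X 1) = X 1 := by simp [substX]

@[simp] theorem substX_X_two : substX c (X 2) = X 2 := by simp [substX]

@[simp] theorem substX_C (r : R) : substX c (C r) = C r := by simp [substX]

variable {c}

theorem sub_dvd_of_substX_eq_zero {F : MvPolynomial (Fin 3) R} (h : substX c F = 0) :
    X 0 - C c * X 1 ∣ F := by
  set I : Ideal (MvPolynomial (Fin 3) R) := Ideal.span {X 0 - C c * X 1}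
  have hcomp : (Ideal.Quotient.mkₐ R I).comp (substX c) = Ideal.Quotient.mkₐ R I := by
    refine MvPolynomial.algHom_ext fun i => ?_
    fin_cases i
    · simp only [Fin.zero_eta, AlgHom.comp_apply, substX_X_zero, Ideal.Quotient.mkₐ_eq_mk]
      exact (Ideal.Quotient.eq.2 (Ideal.mem_span_singleton_self _)).symm
    · simp
    · simp
  have hF := congrArg (fun f => f F) hcomp
  simp only [AlgHom.comp_apply, h, map_zero, Ideal.Quotient.mkₐ_eq_mk] at hF
  exact Ideal.mem_span_singleton.1 (Ideal.Quotient.eq_zero_iff_mem.1 hF.symm)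

theorem mul_sub_dvd_of_substX_eq_zero [IsDomain R] {c₁ c₂ : R} (hc : c₁ ≠ c₂)
    {F : MvPolynomial (Fin 3) R} (h₁ : substX c₁ F = 0) (h₂ : substX c₂ F = 0) :
    (X 0 - C c₁ * X 1) * (X 0 - C c₂ * X 1) ∣ F := by
  obtain ⟨G, rfl⟩ := sub_dvd_of_substX_eq_zero h₁
  refine mul_dvd_mul_left _ (sub_dvd_of_substX_eq_zero ?_)
  have hne : (C c₂ * X 1 - C c₁ * X 1 : MvPolynomial (Fin 3) R) ≠ 0 := by
    rw [← sub_mul, ← C_sub]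
    exact mul_ne_zero (by simpa [sub_eq_zero] using hc.symm) (X_ne_zero 1)
  simpa [hne] using h₂

/-- Cancelling `q` from `x ^ d - z ^ d = q * Q` and `y ^ d - z ^ d = p * P` after substituting
`x ↦ c * y` with `c ^ d = 1`. -/
theorem substX_sub_mul_eq_zero [IsDomain R] {d : ℕ} (hc : c ^ d = 1)
    (hyz : (X 1 ^ d - X 2 ^ d : MvPolynomial (Fin 3) R) ≠ 0)
    {p q g P Q : MvPolynomial (Fin 3) R} (hQ : X 0 ^ d - X 2 ^ d = q * Q)
    (hP : X 1 ^ d - X 2 ^ d = p * P) (hp : substX c q * substX c g = substX c p) :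
    substX c (Q - P * g) = 0 := by
  have hQ' := congrArg (substX c) hQ
  have hP' := congrArg (substX c) hP
  simp only [map_sub, map_pow, map_mul, substX_X_zero, substX_X_one, substX_X_two, mul_pow,
    ← C_pow, hc, C_1, one_mul] at hQ' hP'
  have hq : substX c q ≠ 0 := by
    intro h
    rw [h, zero_mul] at hQ'
    exact hyz hQ'
  refine (mul_eq_zero.1 (?_ : substX c q * substX c (Q - P * g) = 0)).resolve_left hq
  rw [map_sub, map_mul]
  linear_combination hP' - hQ' - substX c P * hp

end SubstX

theorem X_pow_sub_X_pow_ne_zero {R σ : Type*} [CommRing R] [Nontrivial R] {i j : σ} (hij : i ≠ j)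
    {d : ℕ} (hd : d ≠ 0) : (X i ^ d - X j ^ d : MvPolynomial σ R) ≠ 0 := by
  classical
  intro h
  have h' := congrArg (eval fun k => if k = i then (1 : R) else 0) h
  simp [hij.symm, hd] at h'

/-- Rescaling the factors of a product by `c`. -/
theorem prod_C_mul_sub {K σ ι : Type*} [Field K] (s : Finset ι) (c : K)
    (f e : ι → K) (h : ∀ i ∈ s, f i = c * e i) (y z : MvPolynomial σ K) :
    ∏ i ∈ s, (C c * y - C (f i) * z) = C (c ^ s.card) * ∏ i ∈ s, (y - C (e i) * z) := by
  rw [C_pow, ← Finset.prod_const, ← Finset.prod_mul_distrib]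
  refine Finset.prod_congr rfl fun i hi => ?_
  rw [h i hi, C_mul]
  ring

end MatrixFactorization

open MatrixFactorization in
/-- Polynomiality of the morphism component `g⁻₁₁`: `q₋ ∣ x^d − z^d`, `p_μ ∣ y^d − z^d`,
and for the (unique) quotients `Q = (x^d − z^d)/q₋` and `P = (y^d − z^d)/p_μ`, the
polynomial `p₁(x,y)` divides `Q − P·g₀₀`. -/
theorem g11_is_polynomial (d : ℕ) (hd : 2 ≤ d)
    (η : ℂ) (hη : η = Complex.exp (2 * Real.pi * Complex.I / d))
    (a b : ℤ) (μ : ℕ) (hμ : μ ≤ d - 2) :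
    letI x : MvPolynomial (Fin 3) ℂ := X 0
    letI y : MvPolynomial (Fin 3) ℂ := X 1
    letI z : MvPolynomial (Fin 3) ℂ := X 2
    letI p₁ : MvPolynomial (Fin 3) ℂ := (x - C (η ^ a) * y) * (x - C (η ^ (a + 1)) * y)
    letI pmu : MvPolynomial (Fin 3) ℂ :=
      ∏ j ∈ Finset.Icc b (b + (μ : ℤ)), (y - C (η ^ j) * z)
    letI qminus : MvPolynomial (Fin 3) ℂ :=
      ∏ j ∈ Finset.Icc (a + b + 1) (a + b + (μ : ℤ)), (x - C (η ^ j) * z)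
    letI g₀₀ : MvPolynomial (Fin 3) ℂ := C (η ^ (-a * (μ : ℤ))) *
      (C (-η ^ (-a - 1) * ((1 - η ^ (-(μ : ℤ))) / (1 - η ^ (-1 : ℤ)))) * x
        + C ((1 - η ^ (-(μ : ℤ) - 1)) / (1 - η ^ (-1 : ℤ))) * y
        - C (η ^ b) * z)
    (qminus ∣ x ^ d - z ^ d) ∧ (pmu ∣ y ^ d - z ^ d) ∧
      ∀ Q P : MvPolynomial (Fin 3) ℂ,
        x ^ d - z ^ d = qminus * Q → y ^ d - z ^ d = pmu * P → p₁ ∣ Q - P * g₀₀ := by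
  have hd0 : d ≠ 0 := by omega
  have hprim : IsPrimitiveRoot η d := hη ▸ Complex.isPrimitiveRoot_exp d hd0
  have hη0 : η ≠ 0 := hprim.ne_zero hd0
  have hη1 : η ≠ 1 := hprim.ne_one (by omega)
  have hroot (k : ℤ) : (η ^ k) ^ d = 1 := by
    rw [← zpow_natCast, ← zpow_mul, mul_comm, zpow_mul, zpow_natCast, hprim.pow_eq_one, one_zpow]
  have hden : 1 - η ^ (-1 : ℤ) ≠ 0 := by
    rw [zpow_neg_one, sub_ne_zero]
    exact fun h => hη1 (inv_eq_one.1 h.symm)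
  have hIcc₁ : a + b + (μ : ℤ) = a + b + 1 + (μ : ℕ) - 1 := by ring
  have hIcc₂ : b + (μ : ℤ) = b + (μ + 1 : ℕ) - 1 := by push_cast; ring
  have hyz : (X 1 ^ d - X 2 ^ d : MvPolynomial (Fin 3) ℂ) ≠ 0 :=
    X_pow_sub_X_pow_ne_zero (by decide) hd0
  rw [hIcc₁, hIcc₂]
  refine ⟨prod_Icc_sub_dvd_pow_sub_pow hprim (by omega) _ _ _ _ (by omega),
    prod_Icc_sub_dvd_pow_sub_pow hprim (by omega) _ _ _ _ (by omega), fun Q P hQ hP => ?_⟩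
  refine mul_sub_dvd_of_substX_eq_zero ?_ (substX_sub_mul_eq_zero (hroot a) hyz hQ hP ?_)
    (substX_sub_mul_eq_zero (hroot (a + 1)) hyz hQ hP ?_)
  · rw [zpow_add_one₀ hη0]
    intro h
    exact hη1 (mul_left_cancel₀ (zpow_ne_zero a hη0) (h.symm.trans (mul_one _).symm))
  · simp only [prod_Icc_eq_prod_range, map_prod, map_sub, map_add, map_mul, substX_X_zero,
      substX_X_one, substX_X_two, substX_C]
    rw [prod_C_mul_sub (Finset.range μ) (η ^ a) _ (fun i : ℕ => η ^ (b + (i + 1 : ℕ)))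
      (fun i _ => by rw [← zpow_add₀ hη0]; congr 1; push_cast; ring), Finset.prod_range_succ']
    simp only [Finset.card_range, Nat.cast_zero, add_zero]
    have hscale : (C ((η ^ a) ^ μ) * C (η ^ (-a * (μ : ℤ))) : MvPolynomial (Fin 3) ℂ) = 1 := by
      rw [← C_mul, ← zpow_natCast, ← zpow_mul, ← zpow_add₀ hη0, neg_mul, add_neg_cancel, zpow_zero,
        C_1]
    have hcoeff : (C (-η ^ (-a - 1) * ((1 - η ^ (-(μ : ℤ))) / (1 - η ^ (-1 : ℤ)))) * C (η ^ a)
        + C ((1 - η ^ (-(μ : ℤ) - 1)) / (1 - η ^ (-1 : ℤ))) : MvPolynomial (Fin 3) ℂ) = 1 := by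
      rw [← C_mul, ← C_add, ← C_1]
      congr 1
      have h₁ : η ^ (-a - 1) * η ^ a = η ^ (-1 : ℤ) := by
        rw [← zpow_add₀ hη0]; congr 1; ring
      have h₂ : η ^ (-(μ : ℤ) - 1) = η ^ (-(μ : ℤ)) * η ^ (-1 : ℤ) := by
        rw [← zpow_add₀ hη0]; rfl
      rw [h₂, div_eq_mul_inv, div_eq_mul_inv]
      linear_combination mul_inv_cancel₀ hden - (1 - η ^ (-(μ : ℤ))) * (1 - η ^ (-1 : ℤ))⁻¹ * h₁
    rw [C_mul] at hcoeff
    set S := ∏ i ∈ Finset.range μ, (X 1 - C (η ^ (b + (i + 1 : ℕ))) * X 2 : MvPolynomial (Fin 3) ℂ)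
    linear_combination S * (X 1 - C (η ^ b) * X 2) * hscale
      + S * C ((η ^ a) ^ μ) * C (η ^ (-a * (μ : ℤ))) * X 1 * hcoeff
  · simp only [prod_Icc_eq_prod_range, map_prod, map_sub, map_add, map_mul, substX_X_zero,
      substX_X_one, substX_X_two, substX_C]
    rw [prod_C_mul_sub (Finset.range μ) (η ^ (a + 1)) _ (fun i : ℕ => η ^ (b + i))
      (fun i _ => by rw [← zpow_add₀ hη0]; congr 1; ring), Finset.prod_range_succ]
    simp only [Finset.card_range]
    have hscale : (C ((η ^ (a + 1)) ^ μ) * C (η ^ (-a * (μ : ℤ))) : MvPolynomial (Fin 3) ℂ) =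
        C (η ^ (μ : ℤ)) := by
      rw [← C_mul, ← zpow_natCast, ← zpow_mul, ← zpow_add₀ hη0]
      congr 2
      ring
    have hcoeff : (C (-η ^ (-a - 1) * ((1 - η ^ (-(μ : ℤ))) / (1 - η ^ (-1 : ℤ)))) *
          C (η ^ (a + 1))
        + C ((1 - η ^ (-(μ : ℤ) - 1)) / (1 - η ^ (-1 : ℤ))) : MvPolynomial (Fin 3) ℂ) =
        C (η ^ (-(μ : ℤ))) := by
      rw [← C_mul, ← C_add]
      congr 1
      have h₁ : η ^ (-a - 1) * η ^ (a + 1) = 1 := by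
        rw [← zpow_add₀ hη0, show -a - 1 + (a + 1) = 0 by ring, zpow_zero]
      have h₂ : η ^ (-(μ : ℤ) - 1) = η ^ (-(μ : ℤ)) * η ^ (-1 : ℤ) := by
        rw [← zpow_add₀ hη0]; rfl
      rw [h₂, div_eq_mul_inv, div_eq_mul_inv]
      linear_combination η ^ (-(μ : ℤ)) * mul_inv_cancel₀ hden - (1 - η ^ (-(μ : ℤ))) * (1 - η ^ (-1 : ℤ))⁻¹ * h₁
    rw [C_mul] at hcoeff
    have hinv : (C (η ^ (μ : ℤ)) * C (η ^ (-(μ : ℤ))) : MvPolynomial (Fin 3) ℂ) = 1 := by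
      rw [← C_mul, ← zpow_add₀ hη0, add_neg_cancel, zpow_zero, C_1]
    have hadd : (C (η ^ (b + (μ : ℤ))) : MvPolynomial (Fin 3) ℂ) =
        C (η ^ b) * C (η ^ (μ : ℤ)) := by
      rw [← C_mul, ← zpow_add₀ hη0]
    set S := ∏ i ∈ Finset.range μ, (X 1 - C (η ^ (b + (i : ℤ))) * X 2 : MvPolynomial (Fin 3) ℂ)
    linear_combination S * (C (η ^ (-(μ : ℤ))) * X 1 - C (η ^ b) * X 2) * hscale
      + S * C ((η ^ (a + 1)) ^ μ) * C (η ^ (-a * (μ : ℤ))) * X 1 * hcoeff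
      + S * X 1 * hinv + S * X 2 * hadd
end
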